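/- arXiv:2010.05018 — 6 statements merged into one kernel-verified Lean document; each statement's English description precedes it below -/
import Mathlib

section
/- For every q ∈ (0.117, 0.91], one has C_q(39) > 0, i.e. ∫_1^{40} φ_q(x) dx − ∑_{k=2}^{40} φ_q(k) > 0. -/
/-- `φ_q(x) = q^x (q^x - qx + x - 1) / (1 - q^x)²`, with `q^x` the real power. -/
noncomputable def phi (q x : ℝ) : ℝ := q ^ x * (q ^ x - q * x + x - 1) / (1 - q ^ x) ^ 2

open Set

/-! ### Monotonicity of `phi` in the base -/

lemma rpow_sub_one_mul_le_one {q x : ℝ} (hq : 0 < q) (hx : 1 ≤ x) :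
    q ^ (x - 1) * (x - (x - 1) * q) ≤ 1 := by
  have hlog : Real.log q ≤ q - 1 := Real.log_le_sub_one_of_pos hq
  have hle : x - (x - 1) * q ≤ Real.exp (-(Real.log q * (x - 1))) := by
    have := Real.add_one_le_exp (-(Real.log q * (x - 1)))
    nlinarith
  calc q ^ (x - 1) * (x - (x - 1) * q)
      ≤ q ^ (x - 1) * Real.exp (-(Real.log q * (x - 1))) := by gcongr
    _ = 1 := by rw [Real.rpow_def_of_pos hq, ← Real.exp_add, add_neg_cancel, Real.exp_zero]

/-- With `q = exp (-ε)` this reads `tanh (x ε / 2) ≤ x tanh (ε / 2)`. -/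
lemma one_add_mul_one_sub_rpow_le {q x : ℝ} (hq : q ∈ Ioc (0 : ℝ) 1) (hx : 1 ≤ x) :
    (1 + q) * (1 - q ^ x) ≤ x * (1 - q) * (1 + q ^ x) := by
  have hderiv : ∀ y ∈ Ioc (0 : ℝ) 1,
      HasDerivAt (fun y : ℝ ↦ x * (1 - y) * (1 + y ^ x) - (1 + y) * (1 - y ^ x))
        ((x + 1) * (y ^ (x - 1) * (x - (x - 1) * y) - 1)) y := by
    intro y hy
    have hpow := Real.hasDerivAt_rpow_const (p := x) (Or.inl hy.1.ne')
    have hmul : y ^ x = y * y ^ (x - 1) := by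
      rw [← Real.rpow_one_add' hy.1.le (by linarith)]; ring_nf
    have h := ((((hasDerivAt_id y).const_sub 1).const_mul x).mul (hpow.const_add 1)).sub
      (((hasDerivAt_id y).const_add 1).mul (hpow.const_sub 1))
    refine h.congr_deriv ?_
    simp only [id, hmul]
    ring
  have hanti : AntitoneOn (fun y : ℝ ↦ x * (1 - y) * (1 + y ^ x) - (1 + y) * (1 - y ^ x))
      (Ioc 0 1) := by
    refine antitoneOn_of_hasDerivWithinAt_nonpos (convex_Ioc 0 1)
      (fun y hy ↦ (hderiv y hy).continuousAt.continuousWithinAt)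
      (fun y hy ↦ (hderiv y (interior_subset hy)).hasDerivWithinAt) ?_
    intro y hy
    have := rpow_sub_one_mul_le_one (interior_subset hy : y ∈ Ioc (0 : ℝ) 1).1 hx
    exact mul_nonpos_of_nonneg_of_nonpos (by linarith) (by linarith)
  have h := hanti hq (right_mem_Ioc.2 one_pos) hq.2
  simp only [Real.one_rpow] at h
  linarith

lemma phi_eq {q x : ℝ} (h : q ^ x ≠ 1) :
    phi q x = -(q ^ x / (1 - q ^ x)) + (1 - q) * x * (q ^ x / (1 - q ^ x) ^ 2) := by
  have h' : 1 - q ^ x ≠ 0 := sub_ne_zero.2 h.symm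
  unfold phi
  field_simp
  ring

lemma hasDerivAt_phi_base {q x : ℝ} (hq : q ∈ Ioo (0 : ℝ) 1) (hx : 1 ≤ x) :
    HasDerivAt (fun q ↦ phi q x) (x * q ^ (x - 1) / (1 - q ^ x) ^ 3 *
      (x * (1 - q) * (1 + q ^ x) - (1 + q) * (1 - q ^ x))) q := by
  have hlt : q ^ x < 1 := Real.rpow_lt_one hq.1.le hq.2 (by linarith)
  have hne : 1 - q ^ x ≠ 0 := by linarith
  have hpow := Real.hasDerivAt_rpow_const (p := x) (Or.inl hq.1.ne')
  have hmul : q ^ x = q * q ^ (x - 1) := by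
    rw [← Real.rpow_one_add' hq.1.le (by linarith)]; ring_nf
  have h := (hpow.mul (((hpow.sub ((hasDerivAt_id q).mul_const x)).add_const x).sub_const 1)).div
    ((hpow.const_sub 1).pow 2) (pow_ne_zero 2 hne)
  refine h.congr_deriv ?_
  simp only [id, Pi.mul_apply, Pi.sub_apply, Pi.pow_apply]
  rw [hmul] at hne ⊢
  rw [div_mul_eq_mul_div, div_eq_div_iff (pow_ne_zero 2 (pow_ne_zero 2 hne)) (pow_ne_zero 3 hne)]
  push_cast
  ring

lemma phi_monotoneOn_base {x : ℝ} (hx : 1 ≤ x) :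
    MonotoneOn (fun q ↦ phi q x) (Ioo 0 1) := by
  refine monotoneOn_of_hasDerivWithinAt_nonneg (convex_Ioo 0 1)
    (fun q hq ↦ (hasDerivAt_phi_base hq hx).continuousAt.continuousWithinAt)
    (fun q hq ↦ (hasDerivAt_phi_base (interior_subset hq) hx).hasDerivWithinAt) ?_
  intro q hq
  have hq : q ∈ Ioo (0 : ℝ) 1 := interior_subset hq
  have hlt : q ^ x < 1 := Real.rpow_lt_one hq.1.le hq.2 (by linarith)
  have := one_add_mul_one_sub_rpow_le ⟨hq.1, hq.2.le⟩ hx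
  have := Real.rpow_pos_of_pos hq.1 (x - 1)
  have : 0 < 1 - q ^ x := by linarith
  exact mul_nonneg (by positivity) (by linarith)

/-! ### The integral in closed form -/

lemma hasDerivAt_antideriv_phi {q x : ℝ} (hq : q ∈ Ioo (0 : ℝ) 1) (hx : 0 < x) :
    HasDerivAt (fun x ↦ Real.log (1 - q ^ x) / Real.log q + (1 - q) / Real.log q *
      (x * q ^ x / (1 - q ^ x) + Real.log (1 - q ^ x) / Real.log q)) (phi q x) x := by
  have hlt : q ^ x < 1 := Real.rpow_lt_one hq.1.le hq.2 hx
  have hne : 1 - q ^ x ≠ 0 := by linarith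
  have hL : Real.log q ≠ 0 := (Real.log_neg hq.1 hq.2).ne
  have hpow := (Real.hasStrictDerivAt_const_rpow hq.1 x).hasDerivAt
  have hlog := ((hpow.const_sub 1).log hne).div_const (Real.log q)
  have h := hlog.add (((((hasDerivAt_id x).mul hpow).div (hpow.const_sub 1) hne).add
    hlog).const_mul ((1 - q) / Real.log q))
  refine h.congr_deriv ?_
  rw [phi_eq hlt.ne]
  simp only [id, Pi.mul_apply]
  field_simp
  ring

lemma continuousOn_phi {q : ℝ} (hq : q ∈ Ioo (0 : ℝ) 1) : ContinuousOn (phi q) (Ioi 0) := by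
  have hpow : Continuous (fun x : ℝ ↦ q ^ x) :=
    continuous_const.rpow continuous_id fun _ ↦ Or.inl hq.1.ne'
  unfold phi
  refine ContinuousOn.div (Continuous.continuousOn (by fun_prop))
    (Continuous.continuousOn (by fun_prop)) fun x hx ↦ ?_
  have : q ^ x < 1 := Real.rpow_lt_one hq.1.le hq.2 hx
  exact pow_ne_zero 2 (by linarith)

lemma intervalIntegrable_phi {q a b : ℝ} (hq : q ∈ Ioo (0 : ℝ) 1) (ha : 0 < a) (hb : 0 < b) :
    IntervalIntegrable (phi q) MeasureTheory.volume a b :=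
  ((continuousOn_phi hq).mono fun _ hx ↦ (lt_min ha hb).trans_le hx.1).intervalIntegrable

lemma integral_phi {q : ℝ} (hq : q ∈ Ioo (0 : ℝ) 1) {n : ℕ} (hn : 1 ≤ n) :
    (∫ x in (1 : ℝ)..n, phi q x) * Real.log q ^ 2 =
      -Real.log q * (q - n * (1 - q) * (q ^ n / (1 - q ^ n))) -
        (-Real.log q - (1 - q)) * (Real.log (1 - q ^ n) - Real.log (1 - q)) := by
  have hn' : (1 : ℝ) ≤ n := by exact_mod_cast hn
  have hL : Real.log q ≠ 0 := (Real.log_neg hq.1 hq.2).ne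
  have hne : 1 - q ≠ 0 := by linarith [hq.2]
  have hlt : q ^ n < 1 := pow_lt_one₀ hq.1.le hq.2 (by omega)
  have hne' : 1 - q ^ n ≠ 0 := by linarith
  rw [intervalIntegral.integral_eq_sub_of_hasDerivAt
    (fun x hx ↦ hasDerivAt_antideriv_phi hq ?_) (intervalIntegrable_phi hq one_pos (by linarith))]
  · simp only [Real.rpow_natCast, Real.rpow_one]
    field_simp
    ring
  · rw [uIcc_of_le hn'] at hx
    linarith [hx.1]

/-! ### Certified fixed-point bounds

Throughout, a real number `y` is bounded by `n / M` with `n : ℕ` and a common scale `M`. -/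

lemma natCast_div_le_div_add_one (a b : ℕ) : (a : ℝ) / b ≤ ((a / b + 1 : ℕ) : ℝ) := by
  rw [← Nat.floor_div_eq_div (K := ℝ)]
  exact_mod_cast (Nat.lt_floor_add_one ((a : ℝ) / b)).le

/-- An upper bound for `M * log ((s + r) / (s - r))`. -/
def logUpper (M n r s : ℕ) : ℕ :=
  2 * (∑ i ∈ Finset.range n, (M * r ^ (2 * i + 1) / (s ^ (2 * i + 1) * (2 * i + 1)) + 1) +
    (M * r ^ (2 * n + 1) * s ^ 2 / (s ^ (2 * n + 1) * (s ^ 2 - r ^ 2)) + 1))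

lemma log_le_logUpper {M n r s : ℕ} (hrs : r < s) :
    M * Real.log ((s + r) / (s - r)) ≤ logUpper M n r s := by
  have hs : (0 : ℝ) < s := by exact_mod_cast Nat.zero_lt_of_lt hrs
  have hrs' : (r : ℝ) < s := by exact_mod_cast hrs
  have hsq : ((s ^ 2 - r ^ 2 : ℕ) : ℝ) = s ^ 2 - r ^ 2 := by
    push_cast [Nat.pow_le_pow_left hrs.le 2]; rfl
  have hpos : (0 : ℝ) < s ^ 2 - r ^ 2 := by
    have : (0 : ℝ) ≤ r := by positivity
    nlinarith
  have h := Real.log_div_le_sum_range_add (x := (r : ℝ) / s) (by positivity)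
    ((div_lt_one hs).2 hrs') n
  have hfrac : (1 + (r : ℝ) / s) / (1 - r / s) = (s + r) / (s - r) := by
    have : (s : ℝ) - r ≠ 0 := by linarith
    field_simp
  rw [hfrac] at h
  have hsum : M * ∑ i ∈ Finset.range n, ((r : ℝ) / s) ^ (2 * i + 1) / (2 * i + 1) ≤
      ((∑ i ∈ Finset.range n, (M * r ^ (2 * i + 1) / (s ^ (2 * i + 1) * (2 * i + 1)) + 1) : ℕ) :
        ℝ) := by
    rw [Finset.mul_sum, Nat.cast_sum]
    refine Finset.sum_le_sum fun i _ ↦ le_trans (le_of_eq ?_) (natCast_div_le_div_add_one _ _)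
    push_cast
    rw [div_pow]
    field_simp
  have htail : M * (((r : ℝ) / s) ^ (2 * n + 1) / (1 - (r / s) ^ 2)) ≤
      ((M * r ^ (2 * n + 1) * s ^ 2 / (s ^ (2 * n + 1) * (s ^ 2 - r ^ 2)) + 1 : ℕ) : ℝ) := by
    refine le_trans (le_of_eq ?_) (natCast_div_le_div_add_one _ _)
    push_cast [hsq]
    have : (1 : ℝ) - (r / s) ^ 2 ≠ 0 := by
      rw [div_pow, one_sub_div (by positivity)]
      positivity
    rw [div_pow]
    field_simp
  have hM : (0 : ℝ) ≤ M := by positivity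
  have := mul_le_mul_of_nonneg_left h hM
  unfold logUpper
  rw [Nat.cast_mul, Nat.cast_add, Nat.cast_two]
  linarith

/-- An upper bound for `M * ∑ k ∈ Icc 2 n, phi (p / D) k`. -/
def phiSumUpper (M D n p : ℕ) : ℕ :=
  ∑ k ∈ Finset.Icc 2 n,
    (M * p ^ k * (D * p ^ k + (k - 1) * D ^ (k + 1) - k * p * D ^ k) /
      (D * (D ^ k - p ^ k) ^ 2) + 1)

lemma sum_phi_le_phiSumUpper {M D n p : ℕ} (hp : p < D) :
    M * ∑ k ∈ Finset.Icc 2 n, phi ((p : ℝ) / D) k ≤ phiSumUpper M D n p := by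
  have hD : (0 : ℝ) < D := by exact_mod_cast Nat.zero_lt_of_lt hp
  unfold phiSumUpper
  rw [Finset.mul_sum, Nat.cast_sum]
  refine Finset.sum_le_sum fun k hk ↦ le_trans ?_ (natCast_div_le_div_add_one _ _)
  obtain ⟨hk, -⟩ := Finset.mem_Icc.1 hk
  have hpow : p ^ k < D ^ k := Nat.pow_lt_pow_left hp (by omega)
  have hpow' : (0 : ℝ) < D ^ k - p ^ k := sub_pos.2 (by exact_mod_cast hpow)
  have hnum : (D * p ^ k + (k - 1) * D ^ (k + 1) - k * p * D ^ k : ℝ) ≤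
      ((D * p ^ k + (k - 1) * D ^ (k + 1) - k * p * D ^ k : ℕ) : ℝ) := by
    rw [sub_le_iff_le_add]
    have hk' : ((k - 1 : ℕ) : ℝ) = k - 1 := by push_cast [show 1 ≤ k by omega]; rfl
    rw [← hk']
    exact_mod_cast le_tsub_add
  have hphi : M * phi ((p : ℝ) / D) k =
      M * p ^ k * (D * p ^ k + (k - 1) * D ^ (k + 1) - k * p * D ^ k) /
        (D * (D ^ k - p ^ k) ^ 2) := by
    have : (1 : ℝ) - (p / D) ^ k ≠ 0 := by
      rw [div_pow, one_sub_div (by positivity)]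
      positivity
    unfold phi
    rw [Real.rpow_natCast, div_pow, one_sub_div (by positivity)]
    field_simp
    ring
  have hden : ((D * (D ^ k - p ^ k) ^ 2 : ℕ) : ℝ) = D * (D ^ k - p ^ k) ^ 2 := by
    push_cast [hpow.le]; rfl
  rw [hphi, hden, Nat.cast_mul, Nat.cast_mul, Nat.cast_pow]
  gcongr

/-! ### One step of the mesh -/

/-- The integer inequality certifying positivity for all `q ∈ [p / D, p' / D]`. Here `e` and `l`
bound `-log q` and `-log (1 - q)` at `q = p / D`. -/
def stepCheck (M D n N p p' : ℕ) : Bool :=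
  let e := logUpper M N (D - p) (D + p)
  let l := logUpper M N p (2 * D - p)
  let t := M * p ^ n / D ^ n
  let u := M * n * (D - p) * p ^ n / (D * (D ^ n - p ^ n)) + 1
  decide (D * (e * l * M + M * M * t + e * e * phiSumUpper M D n p' + e * u * M) + p * M * l * M <
    e * p * M * M + D * (e * t * M + M * M * l) + p * M * t * M)

lemma quadratic_bound_anti {ε E c X Y S s a v w : ℝ} (hε : 0 < ε) (hE : ε ≤ E) (hc : 0 ≤ c)
    (hcε : c ≤ ε) (hX : 0 ≤ X) (hXY : X ≤ Y) (hS : S ≤ s) (hs : 0 ≤ s) (hvw : v ≤ w)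
    (h : (E - c) * Y + E ^ 2 * s < E * (a - w)) :
    (ε - c) * X + ε ^ 2 * S < ε * (a - v) := by
  have hE0 : 0 < E := hε.trans_le hE
  have h1 : (1 - c / E) * Y + E * s < a - w := by
    have : (1 - c / E) * Y + E * s = ((E - c) * Y + E ^ 2 * s) / E := by field_simp
    rw [this, div_lt_iff₀ hE0]
    linarith
  have h2 : (1 - c / ε) * X ≤ (1 - c / E) * Y := by
    have : c / E ≤ c / ε := by gcongr
    have : c / ε ≤ 1 := (div_le_one hε).2 hcε
    gcongr
    linarith
  have h3 : ε * S ≤ E * s := by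
    calc ε * S ≤ ε * s := by gcongr
      _ ≤ E * s := by gcongr
  have h4 : (ε - c) * X + ε ^ 2 * S = ε * ((1 - c / ε) * X + ε * S) := by field_simp
  rw [h4]
  gcongr
  linarith

lemma sum_lt_integral_of_stepCheck {M D n N p p' : ℕ} (hM : 0 < M) (hn : 1 ≤ n) (hp : 0 < p)
    (hp' : p' < D) (h : stepCheck M D n N p p' = true) {q : ℝ}
    (hq : q ∈ Icc ((p : ℝ) / D) (p' / D)) :
    ∑ k ∈ Finset.Icc (2 : ℕ) n, phi q k < ∫ x in (1 : ℝ)..n, phi q x := by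
  have hM0 : (0 : ℝ) < M := by exact_mod_cast hM
  have hp0 : (0 : ℝ) < p := by exact_mod_cast hp
  have hn1 : (1 : ℝ) ≤ n := by exact_mod_cast hn
  have hD0 : (0 : ℝ) < D := by exact_mod_cast Nat.zero_lt_of_lt hp'
  have hb1 : (p' : ℝ) / D < 1 := (div_lt_one hD0).2 (by exact_mod_cast hp')
  have ha0 : (0 : ℝ) < (p : ℝ) / D := by positivity
  have hqI : q ∈ Ioo (0 : ℝ) 1 := ⟨ha0.trans_le hq.1, hq.2.trans_lt hb1⟩
  have haI : (p : ℝ) / D ∈ Ioo (0 : ℝ) 1 := ⟨ha0, hq.1.trans_lt hqI.2⟩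
  have hbI : (p' : ℝ) / D ∈ Ioo (0 : ℝ) 1 := ⟨hqI.1.trans_le hq.2, hb1⟩
  have hpD : (p : ℝ) < D := (div_lt_one hD0).1 haI.2
  have hpD' : p < D := by exact_mod_cast hpD
  have hsum : ∑ k ∈ Finset.Icc (2 : ℕ) n, phi q k ≤
      ∑ k ∈ Finset.Icc (2 : ℕ) n, phi ((p' : ℝ) / D) k := by
    refine Finset.sum_le_sum fun k hk ↦ phi_monotoneOn_base ?_ hqI hbI hq.2
    exact_mod_cast one_le_two.trans (Finset.mem_Icc.1 hk).1
  have hint : ∫ x in (1 : ℝ)..n, phi ((p : ℝ) / D) x ≤ ∫ x in (1 : ℝ)..n, phi q x :=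
    intervalIntegral.integral_mono_on hn1 (intervalIntegrable_phi haI one_pos (by linarith))
      (intervalIntegrable_phi hqI one_pos (by linarith))
      fun x hx ↦ phi_monotoneOn_base hx.1 haI hqI hq.1
  refine hsum.trans_lt (lt_of_lt_of_le ?_ hint)
  set a : ℝ := (p : ℝ) / D with ha
  set e := logUpper M N (D - p) (D + p)
  set l := logUpper M N p (2 * D - p)
  set t := M * p ^ n / D ^ n
  set u := M * n * (D - p) * p ^ n / (D * (D ^ n - p ^ n)) + 1
  set σ := phiSumUpper M D n p'
  have hε : -Real.log a ≤ (e : ℝ) / M := by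
    rw [le_div_iff₀' hM0]
    refine le_trans (le_of_eq ?_) (log_le_logUpper (by omega))
    rw [← Real.log_inv, ha]
    push_cast [hpD'.le]
    rw [show (D + p - (D - p) : ℝ) = 2 * p by ring]
    congr 2
    field_simp
    ring
  have hℓ : -Real.log (1 - a) ≤ (l : ℝ) / M := by
    rw [le_div_iff₀' hM0]
    refine le_trans (le_of_eq ?_) (log_le_logUpper (by omega))
    have : (D : ℝ) - p ≠ 0 := by linarith
    rw [← Real.log_inv, ha, one_sub_div hD0.ne']
    push_cast [show p ≤ 2 * D by omega]
    rw [show (2 * D - p - p : ℝ) = 2 * (D - p) by ring]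
    congr 2
    field_simp
    ring
  have hτ : (t : ℝ) / M ≤ a ^ n := by
    rw [div_le_iff₀' hM0, ha, div_pow, ← mul_div_assoc]
    exact_mod_cast (Nat.cast_div_le (α := ℝ) (m := M * p ^ n) (n := D ^ n))
  have hpow : a ^ n ≤ a := pow_le_of_le_one haI.1.le haI.2.le (by omega)
  have hv : n * (1 - a) * (a ^ n / (1 - a ^ n)) ≤ (u : ℝ) / M := by
    rw [le_div_iff₀' hM0]
    refine le_trans (le_of_eq ?_) (natCast_div_le_div_add_one _ _)
    have hlt : p ^ n < D ^ n := Nat.pow_lt_pow_left hpD' (by omega)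
    have : (D : ℝ) ^ n - p ^ n ≠ 0 := (sub_pos.2 (by exact_mod_cast hlt)).ne'
    push_cast [hpD'.le, hlt.le]
    rw [ha, div_pow, one_sub_div hD0.ne', one_sub_div (by positivity)]
    field_simp
  have hS : ∑ k ∈ Finset.Icc (2 : ℕ) n, phi ((p' : ℝ) / D) k ≤ (σ : ℝ) / M := by
    rw [le_div_iff₀' hM0]
    exact sum_phi_le_phiSumUpper hp'
  have hL : Real.log a ≤ a - 1 := Real.log_le_sub_one_of_pos haI.1
  have hlogpow : Real.log (1 - a ^ n) ≤ -a ^ n := by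
    have := Real.log_le_sub_one_of_pos (x := 1 - a ^ n) (by linarith [haI.2])
    linarith
  have hlogle : Real.log (1 - a) ≤ Real.log (1 - a ^ n) :=
    Real.log_le_log (by linarith [haI.2]) (by linarith)
  have hcheck : ((e : ℝ) / M - (1 - a)) * (l / M - t / M) + (e / M) ^ 2 * (σ / M) <
      e / M * (a - u / M) := by
    have h0 : D * (e * l * M + M * M * t + e * e * σ + e * u * M) + p * M * l * M <
        e * p * M * M + D * (e * t * M + M * M * l) + p * M * t * M := of_decide_eq_true h
    have h1 : (D * (e * l * M + M * M * t + e * e * σ + e * u * M) + p * M * l * M : ℝ) <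
        e * p * M * M + D * (e * t * M + M * M * l) + p * M * t * M := by exact_mod_cast h0
    rw [← sub_pos] at h1 ⊢
    have h2 : (e : ℝ) / M * (a - u / M) -
        (((e : ℝ) / M - (1 - a)) * (l / M - t / M) + (e / M) ^ 2 * (σ / M)) =
        (e * p * M * M + D * (e * t * M + M * M * l) + p * M * t * M -
          (D * (e * l * M + M * M * t + e * e * σ + e * u * M) + p * M * l * M)) /
          (D * M ^ 3) := by
      rw [ha]
      field_simp
      ring
    rw [h2]
    exact div_pos h1 (mul_pos hD0 (pow_pos hM0 3))
  have hfinal := quadratic_bound_anti (X := Real.log (1 - a ^ n) - Real.log (1 - a))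
    (by linarith [haI.2]) hε (by linarith [haI.2]) (by linarith) (by linarith) (by linarith) hS
    (by positivity) hv hcheck
  have hLsq : 0 < Real.log a ^ 2 := sq_pos_of_neg (Real.log_neg haI.1 haI.2)
  refine lt_of_mul_lt_mul_right ?_ hLsq.le
  rw [integral_phi haI hn]
  linarith

/-! ### The mesh -/

/-- A mesh of `[0.117, 0.91]`, in units of `10⁻⁵`. -/
def mesh : List ℕ := [
    11700, 13935, 16145, 18308, 20411, 22446, 24408, 26296, 28110, 29852, 31523, 33126, 34664,
    36139, 37555, 38914, 40219, 41473, 42679, 43839, 44955, 46029, 47064, 48062, 49024, 49952,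
    50848, 51714, 52551, 53360, 54142, 54899, 55632, 56342, 57031, 57699, 58347, 58976, 59586,
    60179, 60755, 61315, 61859, 62388, 62903, 63405, 63893, 64369, 64833, 65285, 65726, 66156,
    66575, 66984, 67383, 67773, 68154, 68526, 68890, 69245, 69592, 69932, 70264, 70589, 70907,
    71218, 71523, 71822, 72115, 72402, 72683, 72958, 73228, 73492, 73751, 74005, 74255, 74500,
    74740, 74976, 75208, 75435, 75658, 75877, 76092, 76304, 76512, 76716, 76917, 77114, 77308,
    77499, 77687, 77872, 78053, 78232, 78408, 78581, 78751, 78918, 79083, 79245, 79405, 79562,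
    79717, 79869, 80019, 80167, 80313, 80457, 80598, 80737, 80874, 81009, 81142, 81274, 81404,
    81532, 81658, 81782, 81904, 82025, 82144, 82261, 82377, 82491, 82604, 82715, 82825, 82933,
    83040, 83145, 83249, 83352, 83453, 83553, 83652, 83749, 83845, 83940, 84034, 84126, 84217,
    84307, 84396, 84484, 84571, 84656, 84740, 84823, 84905, 84986, 85066, 85145, 85223, 85300,
    85376, 85451, 85525, 85598, 85671, 85743, 85814, 85884, 85953, 86021, 86088, 86154, 86220,
    86285, 86349, 86412, 86474, 86536, 86597, 86657, 86716, 86775, 86833, 86890, 86947, 87003,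
    87058, 87113, 87167, 87220, 87273, 87325, 87376, 87427, 87477, 87526, 87575, 87623, 87671,
    87718, 87765, 87811, 87856, 87901, 87945, 87989, 88032, 88075, 88117, 88159, 88200, 88241,
    88281, 88321, 88360, 88399, 88437, 88475, 88512, 88549, 88585, 88621, 88657, 88692, 88727,
    88761, 88795, 88828, 88861, 88894, 88926, 88958, 88989, 89020, 89051, 89081, 89111, 89140,
    89169, 89198, 89226, 89254, 89282, 89309, 89336, 89363, 89389, 89415, 89441, 89466, 89491,
    89516, 89540, 89564, 89588, 89612, 89635, 89658, 89681, 89703, 89725, 89747, 89769, 89790,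
    89811, 89832, 89853, 89873, 89893, 89913, 89933, 89952, 89971, 89990, 90009, 90027, 90045,
    90063, 90081, 90098, 90115, 90132, 90149, 90166, 90182, 90198, 90214, 90230, 90246, 90261,
    90276, 90291, 90306, 90321, 90335, 90349, 90363, 90377, 90391, 90404, 90417, 90430, 90443,
    90456, 90469, 90481, 90493, 90505, 90517, 90529, 90541, 90553, 90564, 90575, 90586, 90597,
    90608, 90619, 90630, 90640, 90650, 90660, 90670, 90680, 90690, 90700, 90710, 90719, 90728,
    90737, 90746, 90755, 90764, 90773, 90782, 90790, 90798, 90806, 90814, 90822, 90830, 90838,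
    90846, 90854, 90862, 90869, 90876, 90883, 90890, 90897, 90904, 90911, 90918, 90925, 90932,
    90939, 90945, 90951, 90957, 90963, 90969, 90975, 90981, 90987, 90993, 90999, 91000]

lemma exists_mem_Icc_of_isChain {R : ℕ → ℕ → Prop} {D q : ℝ} :
    ∀ {l : List ℕ} {a : ℕ}, (a :: l).IsChain R → (a : ℝ) / D < q →
      q ≤ ((a :: l).getLast (List.cons_ne_nil a l) : ℕ) / D →
      ∃ p p', R p p' ∧ q ∈ Icc ((p : ℝ) / D) (p' / D)
  | [], _, _, ha, hb => absurd hb (not_le.2 ha)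
  | c :: l, a, h, ha, hb => by
    rw [List.isChain_cons_cons] at h
    rcases le_or_gt q ((c : ℝ) / D) with hc | hc
    · exact ⟨a, c, h.1, ha.le, hc⟩
    · exact exists_mem_Icc_of_isChain h.2 hc (by rwa [List.getLast_cons_cons] at hb)

lemma isChain_mesh : mesh.IsChain fun p p' ↦
    0 < p ∧ p' < 10 ^ 5 ∧ stepCheck (10 ^ 12) (10 ^ 5) 40 60 p p' = true := by
  decide +kernel

/-- For `q ∈ (0.117, 0.91]` we have
`C_q(39) = ∫_1^{40} φ_q(x) dx - ∑_{k=2}^{40} φ_q(k) > 0`. -/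
theorem CQ_39_pos (q : ℝ) (hq : q ∈ Set.Ioc (0.117 : ℝ) 0.91) :
    0 < (∫ x in (1 : ℝ)..40, phi q x) - ∑ k ∈ Finset.Icc (2 : ℕ) 40, phi q (k : ℝ) := by
  have hlo : ((11700 : ℕ) : ℝ) / (10 ^ 5 : ℕ) < q := by
    have := hq.1
    norm_num at this ⊢
    linarith
  have hhi : q ≤ ((91000 : ℕ) : ℝ) / (10 ^ 5 : ℕ) := by
    have := hq.2
    norm_num at this ⊢
    linarith
  obtain ⟨p, p', ⟨hp, hp', h⟩, hmem⟩ := exists_mem_Icc_of_isChain isChain_mesh hlo hhi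
  have := sum_lt_integral_of_stepCheck (by norm_num) (by norm_num) hp hp' h hmem
  exact sub_pos.2 (by exact_mod_cast this)
end

section
/- For every q ∈ [0.91, 1), the second derivative of x ↦ φ_q(x) at x = 14 is strictly negative; consequently any real number N > 1 such that φ_q is concave on [1, N] and convex on [N, ∞) satisfies N ≥ 14. -/
open Real Set in
/-- The `[2/1]` Padé approximant of `log` at `1` is an upper bound on `[1, ∞)`. -/
lemma log_le_pade_two_one {s : ℝ} (hs : 1 ≤ s) :
    log s ≤ (s - 1) * (s + 5) / (2 * (2 * s + 1)) := by
  have hder : ∀ x : ℝ, 1 ≤ x →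
      HasDerivAt (fun x : ℝ => (x - 1) * (x + 5) / (2 * (2 * x + 1)) - log x)
        ((x - 1) ^ 3 / (x * (2 * x + 1) ^ 2)) x := by
    intro x hx
    have hx0 : x ≠ 0 := by positivity
    have hx1 : 2 * x + 1 ≠ 0 := by positivity
    have h := ((((hasDerivAt_id' x).sub_const 1).mul ((hasDerivAt_id' x).add_const 5)).div
      ((((hasDerivAt_id' x).const_mul 2).add_const 1).const_mul 2)
        (mul_ne_zero two_ne_zero hx1)).sub (hasDerivAt_log hx0)
    refine h.congr_deriv ?_
    simp only [Pi.mul_apply]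
    field_simp
    ring
  have hmono : MonotoneOn (fun x : ℝ => (x - 1) * (x + 5) / (2 * (2 * x + 1)) - log x)
      (Ici 1) := by
    refine monotoneOn_of_deriv_nonneg (convex_Ici 1)
      (fun x hx => (hder x hx).continuousAt.continuousWithinAt)
      (fun x hx => (hder x (interior_subset hx)).differentiableAt.differentiableWithinAt) ?_
    intro x hx
    have hx1 : 1 ≤ x := interior_subset hx
    rw [(hder x hx1).deriv]
    have : 0 ≤ x - 1 := sub_nonneg.2 hx1
    positivity
  have h := hmono self_mem_Ici hs hs
  simp only [sub_self, zero_mul, zero_div, log_one] at h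
  linarith

lemma neg_log_le_pade {q : ℝ} (h0 : 0 < q) (h1 : q ≤ 1) :
    -Real.log q ≤ (1 - q) * (1 + 5 * q) / (2 * q * (2 + q)) := by
  have h := log_le_pade_two_one ((one_le_inv₀ h0).2 h1)
  rw [Real.log_inv] at h
  refine h.trans_eq ?_
  field_simp

/-- The closed form of the first derivative of `phi q`. -/
noncomputable def phiDeriv (q x : ℝ) : ℝ :=
  q ^ x * ((1 - q - Real.log q) * (1 - q ^ x) + (1 - q) * x * Real.log q * (1 + q ^ x)) /
    (1 - q ^ x) ^ 3

lemma hasDerivAt_phi {q x : ℝ} (h0 : 0 < q) (h1 : q < 1) (hx : 0 < x) :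
    HasDerivAt (phi q) (phiDeriv q x) x := by
  have hy : 1 - q ^ x ≠ 0 := (sub_pos.2 (Real.rpow_lt_one h0.le h1 hx)).ne'
  have hp := (hasDerivAt_id' x).const_rpow h0
  have hid := hasDerivAt_id' x
  have h := (hp.mul (((hp.sub (hid.const_mul q)).add hid).sub_const 1)).div
    ((hp.const_sub 1).pow 2) (pow_ne_zero 2 hy)
  refine h.congr_deriv ?_
  simp only [phiDeriv, Pi.mul_apply, Pi.pow_apply, Pi.add_apply, Pi.sub_apply]
  generalize q ^ x = y at *
  field_simp
  ring

lemma hasDerivAt_phiDeriv {q x : ℝ} (h0 : 0 < q) (h1 : q < 1) (hx : 0 < x) :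
    HasDerivAt (phiDeriv q)
      (q ^ x * Real.log q * ((1 - (q ^ x) ^ 2) * (2 * (1 - q) - Real.log q) +
        (1 - q) * x * Real.log q * (1 + 4 * q ^ x + (q ^ x) ^ 2)) / (1 - q ^ x) ^ 4) x := by
  have hy : 1 - q ^ x ≠ 0 := (sub_pos.2 (Real.rpow_lt_one h0.le h1 hx)).ne'
  have hp := (hasDerivAt_id' x).const_rpow h0
  have hid := hasDerivAt_id' x
  have h := (hp.mul (((hp.const_sub 1).const_mul (1 - q - Real.log q)).add
    (((hid.const_mul (1 - q)).mul_const (Real.log q)).mul (hp.const_add 1)))).div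
    ((hp.const_sub 1).pow 3) (pow_ne_zero 3 hy)
  refine h.congr_deriv ?_
  simp only [Pi.mul_apply, Pi.pow_apply, Pi.add_apply]
  generalize q ^ x = y at *
  field_simp
  ring

lemma deriv_deriv_phi {q x : ℝ} (h0 : 0 < q) (h1 : q < 1) (hx : 0 < x) :
    deriv (deriv (phi q)) x =
      q ^ x * Real.log q * ((1 - (q ^ x) ^ 2) * (2 * (1 - q) - Real.log q) +
        (1 - q) * x * Real.log q * (1 + 4 * q ^ x + (q ^ x) ^ 2)) / (1 - q ^ x) ^ 4 := by
  have h : deriv (phi q) =ᶠ[nhds x] phiDeriv q := by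
    filter_upwards [lt_mem_nhds hx] with z hz using (hasDerivAt_phi h0 h1 hz).deriv
  rw [h.deriv_eq, (hasDerivAt_phiDeriv h0 h1 hx).deriv]

lemma septic_pos {a : ℝ} (h0 : 0 ≤ a) (h1 : a ≤ 0.09) :
    0 < 84 - 1190 * a + 10570 * a ^ 2 - 175357 * a ^ 3 + 1714622 * a ^ 4 - 10477948 * a ^ 5 +
      45507462 * a ^ 6 - 151603023 * a ^ 7 := by
  obtain ⟨b, hb⟩ : ∃ b, b = 0.09 - a := ⟨_, rfl⟩
  have hb0 : 0 ≤ b := by rw [hb]; exact sub_nonneg.2 h1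
  have key : 0.09 ^ 7 * (84 - 1190 * a + 10570 * a ^ 2 - 175357 * a ^ 3 + 1714622 * a ^ 4 -
      10477948 * a ^ 5 + 45507462 * a ^ 6 - 151603023 * a ^ 7) =
      84 * b ^ 7 + 480.9 * (a * b ^ 6) + 1207.017 * (a ^ 2 * b ^ 5) +
      1633.749747 * (a ^ 3 * b ^ 4) + 1255.32533742 * (a ^ 4 * b ^ 3) +
      522.2762951148 * (a ^ 5 * b ^ 2) + 100.075097082342 * (a ^ 6 * b) +
      2.24026679438913 * a ^ 7 := by
    rw [hb]; ring
  have hpos : 0 < 84 * b ^ 7 + 480.9 * (a * b ^ 6) + 1207.017 * (a ^ 2 * b ^ 5) +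
      1633.749747 * (a ^ 3 * b ^ 4) + 1255.32533742 * (a ^ 4 * b ^ 3) +
      522.2762951148 * (a ^ 5 * b ^ 2) + 100.075097082342 * (a ^ 6 * b) +
      2.24026679438913 * a ^ 7 := by
    rcases h0.eq_or_lt with rfl | ha
    · rw [hb]; norm_num
    · positivity
  rw [← key] at hpos
  exact pos_of_mul_pos_right hpos (by norm_num)

lemma polynomial_inequality {q : ℝ} (h0 : 0.91 ≤ q) (h1 : q < 1) :
    14 * (1 - q) * (1 + 5 * q) * (1 + 4 * q ^ 14 + (q ^ 14) ^ 2) <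
      (1 - (q ^ 14) ^ 2) * (1 + 13 * q + 4 * q ^ 2) := by
  obtain ⟨a, rfl⟩ : ∃ a, q = 1 - a := ⟨1 - q, by ring⟩
  have ha : 0 < a := by linarith
  have ha1 : a ≤ 0.09 := by linarith
  have hp := septic_pos ha.le ha1
  have tail : ∀ (k : ℕ) (c d : ℝ), 0 ≤ d → d * 0.09 ≤ c → 0 ≤ a ^ k * (c - d * a) := by
    intro k c d hd hcd
    have := mul_le_mul_of_nonneg_left ha1 hd
    exact mul_nonneg (by positivity) (by linarith)
  have hH := add_pos_of_pos_of_nonneg hp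
    (add_nonneg (tail 8 405567162 896972986 (by norm_num) (by norm_num))
    (add_nonneg (tail 10 1671809594 2660040061 (by norm_num) (by norm_num))
    (add_nonneg (tail 12 3644623294 4324573736 (by norm_num) (by norm_num))
    (add_nonneg (tail 14 4458960370 4001217885 (by norm_num) (by norm_num))
    (add_nonneg (tail 16 3124493190 2119727610 (by norm_num) (by norm_num))
    (add_nonneg (tail 18 1245314070 630353295 (by norm_num) (by norm_num))
    (add_nonneg (tail 20 272948130 100112220 (by norm_num) (by norm_num))
    (add_nonneg (tail 22 30687930 7717437 (by norm_num) (by norm_num))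
    (add_nonneg (tail 24 1550934 239526 (by norm_num) (by norm_num))
    (add_nonneg (tail 26 26694 1911 (by norm_num) (by norm_num))
    (tail 28 66 0 (by norm_num) (by norm_num))))))))))))
  rw [← sub_pos]
  refine (mul_pos (pow_pos ha 2) hH).trans_eq ?_
  ring

/-- For `q ∈ [0.91, 1)`, `φ_q''(14) < 0`; consequently every `N > 1` such that `φ_q` is
concave on `[1, N]` and convex on `[N, ∞)` satisfies `N ≥ 14`. -/
theorem phi_second_deriv_neg_at_14 (q : ℝ) (hq : q ∈ Set.Ico (0.91 : ℝ) 1) :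
    deriv (deriv (phi q)) 14 < 0 ∧
      ∀ N : ℝ, 1 < N → ConcaveOn ℝ (Set.Icc (1 : ℝ) N) (phi q) →
        ConvexOn ℝ (Set.Ici N) (phi q) → 14 ≤ N := by
  obtain ⟨h91, h1⟩ := hq
  have h0 : 0 < q := lt_of_lt_of_le (by norm_num) h91
  have hneg : deriv (deriv (phi q)) 14 < 0 := by
    rw [deriv_deriv_phi h0 h1 (by norm_num), show q ^ (14 : ℝ) = q ^ 14 by norm_cast]
    have hpoly := polynomial_inequality h91 h1
    have hy0 : 0 < q ^ 14 := pow_pos h0 14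
    have hy1 : q ^ 14 < 1 := pow_lt_one₀ h0.le h1 (by norm_num)
    have hlog := Real.log_neg h0 h1
    have hpade := neg_log_le_pade h0 h1.le
    generalize q ^ 14 = y at *
    obtain ⟨l, hl⟩ : ∃ l, l = -Real.log q := ⟨_, rfl⟩
    have hlq : Real.log q = -l := by rw [hl, neg_neg]
    rw [hlq] at hlog hpade ⊢
    have hK : 0 < 2 * q * (2 + q) := by positivity
    rw [neg_neg, le_div_iff₀ hK] at hpade
    have ha : 0 < 1 - q := sub_pos.2 h1
    have hy2 : 0 < 1 - y ^ 2 := by nlinarith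
    have hbr : 0 < (1 - y ^ 2) * (2 * (1 - q) - -l) +
        (1 - q) * 14 * -l * (1 + 4 * y + y ^ 2) := by
      rcases le_total (14 * (1 - q) * (1 + 4 * y + y ^ 2)) (1 - y ^ 2) with h | h
      · have h2 := mul_nonneg (sub_nonneg.2 h) (neg_neg_iff_pos.1 hlog).le
        have h3 := mul_pos hy2 ha
        linarith
      · have h2 := mul_le_mul_of_nonneg_left hpade (sub_nonneg.2 h)
        have h3 := mul_lt_mul_of_pos_left hpoly ha
        refine pos_of_mul_pos_right (a := 2 * q * (2 + q)) ?_ hK.le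
        linarith
    have hy4 : 0 < (1 - y) ^ 4 := pow_pos (sub_pos.2 hy1) 4
    exact div_neg_of_neg_of_pos
      (mul_neg_of_neg_of_pos (mul_neg_of_pos_of_neg hy0 hlog) hbr) hy4
  refine ⟨hneg, fun N hN _ hconv => ?_⟩
  by_contra! hlt
  have hmono := hconv.monotoneOn_deriv fun x hx =>
    (hasDerivAt_phi h0 h1 (zero_lt_one.trans (hN.trans_le hx))).differentiableAt
  have h := hmono.derivWithin_nonneg (x := 14)
  rw [derivWithin_of_mem_nhds (Ici_mem_nhds hlt)] at h
  exact hneg.not_ge h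
end

section
/- Let q ∈ (0,1), let j ≥ 1 be an integer, and let ω ≥ 0. Suppose there exist real numbers M and N with 1 < M < N, j ≤ N ≤ j+1, such that φ_q is concave on [1, N], increasing on [1, M], decreasing on [M, ∞), and φ_q'(x) ≥ −ω for all x ∈ [j, j+1]. Then ρ_q(j) ≥ −ω/2. -/
/-- `ρ_q(j) = ∫_j^{j+1} φ_q(x) dx - (φ_q(j) + φ_q(j+1))/2`. -/
noncomputable def rhoQ (q : ℝ) (j : ℕ) : ℝ :=
  (∫ x in (j : ℝ)..((j : ℝ) + 1), phi q x) - (phi q (j : ℝ) + phi q ((j : ℝ) + 1)) / 2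

lemma differentiableAt_phi {q x : ℝ} (hq : q ∈ Set.Ioo (0 : ℝ) 1) (hx : 0 < x) :
    DifferentiableAt ℝ (phi q) x := by
  have hlt : q ^ x < 1 := Real.rpow_lt_one hq.1.le hq.2 hx
  have hpow : DifferentiableAt ℝ (fun y : ℝ => q ^ y) x :=
    (Real.hasStrictDerivAt_const_rpow hq.1 x).hasDerivAt.differentiableAt
  have hne : (1 - q ^ x) ^ 2 ≠ 0 := pow_ne_zero 2 (sub_pos.2 hlt).ne'
  unfold phi
  fun_prop (disch := assumption)

/-- A function that dominates the affine map `x ↦ c + m (x - a)` on `[a, a + 1]` has integral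
at least `c + m / 2` there. -/
lemma add_half_le_integral_of_affine_le {f : ℝ → ℝ} {a c m : ℝ}
    (hf : ContinuousOn f (Set.Icc a (a + 1)))
    (h : ∀ x ∈ Set.Icc a (a + 1), c + m * (x - a) ≤ f x) :
    c + m / 2 ≤ ∫ x in a..(a + 1), f x := by
  have haffine : ∫ x in a..(a + 1), (c + m * (x - a)) = c + m / 2 := by
    rw [intervalIntegral.integral_comp_sub_right (fun x => c + m * x),
      intervalIntegral.integral_add (by simp) (Continuous.intervalIntegrable (by fun_prop) _ _),
      intervalIntegral.integral_const_mul, integral_id, intervalIntegral.integral_const]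
    simp
    ring
  rw [← haffine]
  exact intervalIntegral.integral_mono_on (by linarith)
    (Continuous.intervalIntegrable (by fun_prop) _ _)
    (hf.intervalIntegrable_of_Icc (by linarith)) h

/-- If `f` is concave on `[a, M]` with `M ≤ a + 1`, antitone on `[M, ∞)` and
`f a ≤ f (a + 1)`, then `f` lies above its chord on `[a, a + 1]`. -/
lemma chord_le_of_concaveOn_of_antitoneOn {f : ℝ → ℝ} {a M x : ℝ} (haM : a < M)
    (hM : M ≤ a + 1) (hconc : ConcaveOn ℝ (Set.Icc a M) f) (hanti : AntitoneOn f (Set.Ici M))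
    (hle : f a ≤ f (a + 1)) (hx : x ∈ Set.Icc a (a + 1)) :
    f a + (f (a + 1) - f a) * (x - a) ≤ f x := by
  obtain ⟨hax, hx1⟩ := hx
  rcases le_total M x with hMx | hxM
  · have hfx : f (a + 1) ≤ f x := hanti hMx hM hx1
    nlinarith
  · have hfM : f (a + 1) ≤ f M := hanti Set.self_mem_Ici hM hM
    have hMa : 0 < M - a := sub_pos.2 haM
    have hchord := hconc.2 (Set.left_mem_Icc.2 haM.le) (Set.right_mem_Icc.2 haM.le)
      (div_nonneg (sub_nonneg.2 hxM) hMa.le) (div_nonneg (sub_nonneg.2 hax) hMa.le)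
      (by field_simp; ring)
    have hpt : ((M - x) / (M - a)) • a + ((x - a) / (M - a)) • M = x := by
      simp only [smul_eq_mul]
      field_simp
      ring
    rw [hpt] at hchord
    have hweight : (M - x) / (M - a) = 1 - (x - a) / (M - a) := by
      field_simp
      ring
    have hscale : x - a ≤ (x - a) / (M - a) :=
      le_div_self (sub_nonneg.2 hax) hMa (by linarith)
    rw [hweight] at hchord
    simp only [smul_eq_mul] at hchord
    nlinarith

/-- If `1 < M < N`, `j ≤ N ≤ j+1`, `φ_q` is concave on `[1, N]`, increasing on `[1, M]`,
decreasing on `[M, ∞)`, and `φ_q'(x) ≥ -ω` on `[j, j+1]` with `ω ≥ 0`, then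
`ρ_q(j) ≥ -ω/2`. -/
theorem rhoQ_lower_bound (q : ℝ) (hq : q ∈ Set.Ioo (0 : ℝ) 1) (j : ℕ) (hj : 1 ≤ j)
    (ω : ℝ) (hω : 0 ≤ ω) (M N : ℝ) (hM : 1 < M) (hMN : M < N)
    (hjN : (j : ℝ) ≤ N) (hNj : N ≤ (j : ℝ) + 1)
    (hconc : ConcaveOn ℝ (Set.Icc (1 : ℝ) N) (phi q))
    (hmono : MonotoneOn (phi q) (Set.Icc (1 : ℝ) M))
    (hanti : AntitoneOn (phi q) (Set.Ici M))
    (hder : ∀ x ∈ Set.Icc (j : ℝ) ((j : ℝ) + 1), -ω ≤ deriv (phi q) x) :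
    -(ω / 2) ≤ rhoQ q j := by
  have hj1 : (1 : ℝ) ≤ j := by exact_mod_cast hj
  have hdiff : ∀ x ∈ Set.Icc (j : ℝ) (j + 1), DifferentiableAt ℝ (phi q) x := fun x hx =>
    differentiableAt_phi hq (by linarith [hx.1])
  have hcont : ContinuousOn (phi q) (Set.Icc (j : ℝ) (j + 1)) := fun x hx =>
    (hdiff x hx).continuousAt.continuousWithinAt
  unfold rhoQ
  rcases le_total (phi q (j + 1)) (phi q j) with hle | hle
  · have hint := add_half_le_integral_of_affine_le (c := phi q j) (m := -ω) hcont
      fun x hx => by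
        have hmvt := (convex_Icc (j : ℝ) (j + 1)).mul_sub_le_image_sub_of_le_deriv hcont
          (fun y hy => (hdiff y (interior_subset hy)).differentiableWithinAt)
          (fun y hy => hder y (interior_subset hy)) j (Set.left_mem_Icc.2 (by linarith))
          x hx hx.1
        linarith
    linarith
  · suffices hchord : ∀ x ∈ Set.Icc (j : ℝ) (j + 1),
        phi q j + (phi q (j + 1) - phi q j) * (x - j) ≤ phi q x by
      have hint := add_half_le_integral_of_affine_le hcont hchord
      linarith
    intro x hx
    rcases le_or_gt M j with hMj | hjM
    · have hfx : phi q (j + 1) ≤ phi q x :=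
        hanti (hMj.trans hx.1) (show M ≤ (j : ℝ) + 1 by linarith) hx.2
      nlinarith [hx.1, hx.2]
    · exact chord_le_of_concaveOn_of_antitoneOn hjM (by linarith)
        (hconc.subset (Set.Icc_subset_Icc hj1 hMN.le) (convex_Icc _ _)) hanti hle hx
end

section
/- For every q ∈ [0.91, 1), the function Θ_q(x) = (−q^x log(q)/(1−q^x)²)·(−x(1−q)(1+q^x)/(1−q^x) + q − (1−q)/log(q)) is increasing (monotone nondecreasing) on (0, ∞). -/
/-- `Θ_q(x) = (-q^x log q/(1-q^x)²) * (-x(1-q)(1+q^x)/(1-q^x) + q - (1-q)/log q)`. -/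
noncomputable def Theta (q x : ℝ) : ℝ :=
  -q ^ x * Real.log q / (1 - q ^ x) ^ 2 *
    (-(x * (1 - q) * (1 + q ^ x)) / (1 - q ^ x) + q - (1 - q) / Real.log q)

theorem Real.sinh_le_mul_cosh {u : ℝ} (hu : 0 ≤ u) : Real.sinh u ≤ u * Real.cosh u := by
  have hd (x : ℝ) : HasDerivAt (fun x : ℝ => x * Real.cosh x - Real.sinh x)
      (x * Real.sinh x) x := by
    refine HasDerivAt.congr_deriv (((hasDerivAt_id x).mul (Real.hasDerivAt_cosh x)).sub (Real.hasDerivAt_sinh x)) ?_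
    simp
  have hm : MonotoneOn (fun x : ℝ => x * Real.cosh x - Real.sinh x) (Set.Ici 0) := by
    refine monotoneOn_of_deriv_nonneg (convex_Ici 0)
      (fun x _ => (hd x).continuousAt.continuousWithinAt)
      (fun x _ => (hd x).differentiableAt.differentiableWithinAt) fun x hx => ?_
    rw [interior_Ici, Set.mem_Ioi] at hx
    rw [(hd x).deriv]
    exact mul_nonneg hx.le (Real.sinh_nonneg_iff.2 hx.le)
  simpa using hm Set.self_mem_Ici hu hu

theorem Real.three_mul_cosh_mul_sinh_le {u : ℝ} (hu : 0 ≤ u) :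
    3 * (Real.cosh u * Real.sinh u) ≤ u * (3 * Real.cosh u ^ 2 - Real.sinh u ^ 2) := by
  have hd (x : ℝ) : HasDerivAt (fun x : ℝ => x * (3 * Real.cosh x ^ 2 - Real.sinh x ^ 2)
      - 3 * (Real.cosh x * Real.sinh x))
      (4 * Real.sinh x * (x * Real.cosh x - Real.sinh x)) x := by
    have hc := Real.hasDerivAt_cosh x
    have hs := Real.hasDerivAt_sinh x
    refine HasDerivAt.congr_deriv (((hasDerivAt_id x).mul (((hc.pow 2).const_mul 3).sub (hs.pow 2))).sub
      ((hc.mul hs).const_mul 3)) ?_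
    simp
    ring
  have hm : MonotoneOn (fun x : ℝ => x * (3 * Real.cosh x ^ 2 - Real.sinh x ^ 2)
      - 3 * (Real.cosh x * Real.sinh x)) (Set.Ici 0) := by
    refine monotoneOn_of_deriv_nonneg (convex_Ici 0)
      (fun x _ => (hd x).continuousAt.continuousWithinAt)
      (fun x _ => (hd x).differentiableAt.differentiableWithinAt) fun x hx => ?_
    rw [interior_Ici, Set.mem_Ioi] at hx
    rw [(hd x).deriv]
    exact mul_nonneg (mul_nonneg (by norm_num) (Real.sinh_nonneg_iff.2 hx.le))
      (sub_nonneg.2 (Real.sinh_le_mul_cosh hx.le))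
  simpa using hm Set.self_mem_Ici hu hu

theorem monotoneOn_div_sinh_sq_sub {a c : ℝ} (hc : 0 ≤ c) (hac : a ≤ c) :
    MonotoneOn (fun u : ℝ => (a + c) / Real.sinh u ^ 2
      - 2 * c * (u * Real.cosh u) / Real.sinh u ^ 3) (Set.Ioi 0) := by
  have hd (x : ℝ) (hx : 0 < x) : HasDerivAt (fun u : ℝ => (a + c) / Real.sinh u ^ 2
      - 2 * c * (u * Real.cosh u) / Real.sinh u ^ 3)
      (2 * (c * (x * (3 * Real.cosh x ^ 2 - Real.sinh x ^ 2)) -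
        (a + 2 * c) * (Real.cosh x * Real.sinh x)) / Real.sinh x ^ 4) x := by
    have h0 : Real.sinh x ≠ 0 := (Real.sinh_pos_iff.2 hx).ne'
    have hc := Real.hasDerivAt_cosh x
    have hs := Real.hasDerivAt_sinh x
    refine HasDerivAt.congr_deriv (((hasDerivAt_const x (a + c)).div (hs.pow 2) (pow_ne_zero 2 h0)).sub
      ((((hasDerivAt_id x).mul hc).const_mul (2 * c)).div (hs.pow 3) (pow_ne_zero 3 h0))) ?_
    simp
    field_simp
    ring
  refine monotoneOn_of_deriv_nonneg (convex_Ioi 0)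
    (fun x hx => (hd x hx).continuousAt.continuousWithinAt)
    (fun x hx => (hd x (by simpa using hx)).differentiableAt.differentiableWithinAt) fun x hx => ?_
  rw [interior_Ioi, Set.mem_Ioi] at hx
  rw [(hd x hx).deriv]
  have hp : 0 ≤ Real.cosh x * Real.sinh x :=
    mul_nonneg (Real.cosh_pos x).le (Real.sinh_nonneg_iff.2 hx.le)
  have h := mul_le_mul_of_nonneg_left (Real.three_mul_cosh_mul_sinh_le hx.le) hc
  have h' := mul_le_mul_of_nonneg_right hac hp
  exact div_nonneg (by linarith) (by positivity)

theorem Theta_eq_sinh {q x : ℝ} (hq0 : 0 < q) (hq1 : q < 1) (hx : 0 < x) :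
    Theta q x = -Real.log q / 4 * ((q + (1 - q) / -Real.log q)
      / Real.sinh (x * (-Real.log q / 2)) ^ 2
      - 2 * ((1 - q) / -Real.log q) * (x * (-Real.log q / 2)
        * Real.cosh (x * (-Real.log q / 2))) / Real.sinh (x * (-Real.log q / 2)) ^ 3) := by
  have hL : Real.log q < 0 := Real.log_neg hq0 hq1
  set L := Real.log q with hLdef
  have hqx : q ^ x = Real.exp (x * (L / 2)) ^ 2 := by
    rw [Real.rpow_def_of_pos hq0, ← Real.exp_nat_mul]
    congr 1
    push_cast
    ring
  have hlt : Real.exp (x * (L / 2)) < 1 := Real.exp_lt_one_iff.2 (by nlinarith)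
  have hpos := Real.exp_pos (x * (L / 2))
  rw [Theta, ← hLdef, hqx, Real.sinh_eq, Real.cosh_eq,
    show -(x * (-L / 2)) = x * (L / 2) by ring, show x * (-L / 2) = -(x * (L / 2)) by ring,
    Real.exp_neg]
  set e := Real.exp (x * (L / 2))
  have h1 : 1 - e ^ 2 ≠ 0 := by nlinarith
  have h2 : e⁻¹ - e = (1 - e ^ 2) / e := by field_simp
  have h3 : e⁻¹ + e = (1 + e ^ 2) / e := by field_simp
  have hL' := hL.ne
  rw [h2, h3]
  field_simp
  ring

/-- For `q ∈ [0.91, 1)`, the function `Θ_q` is monotone nondecreasing on `(0, ∞)`. -/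
theorem Theta_monotoneOn (q : ℝ) (hq : q ∈ Set.Ico (0.91 : ℝ) 1) :
    MonotoneOn (Theta q) (Set.Ioi (0 : ℝ)) := by
  obtain ⟨hq0, hq1⟩ := hq
  replace hq0 : 0 < q := lt_of_lt_of_le (by norm_num) hq0
  have hL : 0 < -Real.log q := neg_pos.2 (Real.log_neg hq0 hq1)
  have hqc : q ≤ (1 - q) / -Real.log q := by
    rw [le_div_iff₀ hL]
    have h := mul_le_mul_of_nonneg_left (Real.one_sub_inv_le_log_of_pos hq0) hq0.le
    rw [mul_sub, mul_inv_cancel₀ hq0.ne'] at h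
    linarith
  intro x hx y hy hxy
  rw [Theta_eq_sinh hq0 hq1 hx, Theta_eq_sinh hq0 hq1 hy]
  exact mul_le_mul_of_nonneg_left (monotoneOn_div_sinh_sq_sub (hq0.le.trans hqc) hqc
    (mul_pos hx (half_pos hL)) (mul_pos hy (half_pos hL)) (by gcongr)) (by positivity)
end

section
/- For every q ∈ [0.91, 1) and every real x ≥ 1, the derivative of x ↦ φ_q(x) satisfies φ_q'(x) ≥ −0.035. -/
theorem hasDerivAt_phi_s18 {q x : ℝ} (hq : 0 < q) (hQ : q ^ x ≠ 1) :
    HasDerivAt (phi q)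
      (q ^ x / (1 - q ^ x) ^ 3 *
        ((1 - q - Real.log q) * (1 - q ^ x) + (1 - q) * (x * Real.log q) * (1 + q ^ x))) x := by
  have hne : 1 - q ^ x ≠ 0 := sub_ne_zero.mpr hQ.symm
  have hpow : HasDerivAt (fun y : ℝ => q ^ y) (q ^ x * Real.log q) x :=
    (Real.hasStrictDerivAt_const_rpow hq x).hasDerivAt
  have hlin : HasDerivAt (fun y : ℝ => q * y) q x := by
    simpa using (hasDerivAt_id x).const_mul q
  have hnum := hpow.mul (((hpow.sub hlin).add (hasDerivAt_id x)).sub_const 1)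
  have hden := (hpow.const_sub 1).pow 2
  refine (hnum.div hden (pow_ne_zero 2 hne)).congr_deriv ?_
  simp only [Pi.mul_apply, Pi.add_apply, Pi.sub_apply, Pi.pow_apply, id]
  field_simp
  ring

theorem neg_log_mul_sqrt_le {Q : ℝ} (h0 : 0 < Q) (h1 : Q ≤ 1) : -Real.log Q * √Q ≤ 1 - Q := by
  have hs : 0 < √Q := Real.sqrt_pos.mpr h0
  have h := Real.self_le_sinh_iff.mpr
    (neg_nonneg.mpr (Real.log_nonpos hs.le (Real.sqrt_le_one.mpr h1)))
  rw [Real.sinh_neg, Real.sinh_log hs, Real.log_sqrt h0.le] at h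
  have h' := mul_le_mul_of_nonneg_right h hs.le
  have hinv : (√Q)⁻¹ * √Q = 1 := inv_mul_cancel₀ hs.ne'
  nlinarith [Real.mul_self_sqrt h0.le]

theorem neg_div_four_le_deriv_phi {q x : ℝ} (h0 : 0 < q) (h1 : q < 1) (hx : 0 < x) :
    -((1 - q) / 4) ≤ deriv (phi q) x := by
  have hQ0 : 0 < q ^ x := Real.rpow_pos_of_pos h0 x
  have hQ1 : q ^ x < 1 := Real.rpow_lt_one h0.le h1 hx
  rw [(hasDerivAt_phi_s18 h0 hQ1.ne).deriv]
  have ht := neg_log_mul_sqrt_le hQ0 hQ1.le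
  rw [Real.log_rpow h0] at ht
  have hlog : 1 - q ≤ -Real.log q := by linarith [Real.log_le_sub_one_of_pos h0]
  have hs0 : 0 < √(q ^ x) := Real.sqrt_pos.mpr hQ0
  have hsq : q ^ x = √(q ^ x) ^ 2 := (Real.sq_sqrt hQ0.le).symm
  generalize √(q ^ x) = s at *
  generalize x * Real.log q = l at *
  rw [hsq] at hQ1 ht ⊢
  have hs1 : s < 1 := by nlinarith
  have ha : 0 < 1 - q := by linarith
  have hd : 0 < 1 - s ^ 2 := by linarith
  have hl : -((1 - s ^ 2) / s) ≤ l := by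
    rw [neg_le, le_div_iff₀ hs0]; exact ht
  calc -((1 - q) / 4) ≤ -((1 - q) * (s / (1 + s) ^ 2)) := by
        have : s / (1 + s) ^ 2 ≤ 1 / 4 := by
          rw [div_le_div_iff₀ (by positivity) (by norm_num)]
          nlinarith [sq_nonneg (1 - s)]
        nlinarith
    _ = s ^ 2 / (1 - s ^ 2) ^ 3 *
          ((1 - q + (1 - q)) * (1 - s ^ 2) + (1 - q) * (-((1 - s ^ 2) / s)) * (1 + s ^ 2)) := by
        have : 1 - s ≠ 0 := by linarith
        rw [show 1 - s ^ 2 = (1 - s) * (1 + s) by ring]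
        field_simp
        ring
    _ ≤ _ := by
        rw [sub_eq_add_neg (1 - q) (Real.log q)]
        gcongr

/-- For `q ∈ [0.91, 1)` and `x ≥ 1`, `φ_q'(x) ≥ -0.035`. -/
theorem phi_deriv_lower_bound (q : ℝ) (hq : q ∈ Set.Ico (0.91 : ℝ) 1) (x : ℝ)
    (hx : 1 ≤ x) : -0.035 ≤ deriv (phi q) x := by
  obtain ⟨hq0, hq1⟩ := hq
  norm_num at hq0
  have h := neg_div_four_le_deriv_phi (q := q) (x := x) (by linarith) hq1 (by linarith)
  norm_num
  linarith
end

section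
/- For every q ∈ [0.91, 1), one has D_q(10) > 0.036, i.e. ∫_1^{11} φ_q(x) dx − (∑_{k=1}^{10} φ_q(k) + φ_q(11)/2) > 0.036. -/
/-- A Taylor upper bound for `exp` that stays valid slightly beyond `1`. -/
lemma exp_le_taylor_seven {y : ℝ} (h0 : 0 ≤ y) (h1 : y ≤ 26 / 25) :
    Real.exp y ≤ 1 + y + y ^ 2 / 2 + y ^ 3 / 6 + y ^ 4 / 24 + y ^ 5 / 120 + y ^ 6 / 720
      + y ^ 7 / 5040 + y ^ 8 / 20000 := by
  obtain ⟨z, rfl⟩ : ∃ z, y = 2 * z := ⟨y / 2, by ring⟩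
  have hz0 : 0 ≤ z := by linarith
  have hz1 : z ≤ 13 / 25 := by linarith
  have hb := Real.exp_bound' hz0 (by linarith) (n := 9) (by norm_num)
  norm_num [Finset.sum_range_succ, Nat.factorial] at hb
  have hsq := pow_le_pow_left₀ (Real.exp_pos z).le hb 2
  rw [← Real.exp_nat_mul] at hsq
  push_cast at hsq
  refine hsq.trans ?_
  rw [← sub_nonneg]
  have hp : ∀ n : ℕ, z ^ (n + 8) ≤ z ^ 8 * (13 / 25) ^ n := fun n => by
    rw [pow_add, mul_comm]
    gcongr
  have h9 := hp 1
  have h10 := hp 2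
  have h11 := hp 3
  have h12 := hp 4
  have h13 := hp 5
  have h14 := hp 6
  have h15 := hp 7
  have h16 := hp 8
  have h17 := hp 9
  have h18 := hp 10
  have h8 : 0 ≤ z ^ 8 := by positivity
  norm_num at h9 h10 h11 h12 h13 h14 h15 h16 h17 h18
  ring_nf
  linarith

/-- Two-sided Bernoulli-type bounds for `1 / (exp y - 1)`, multiplied by `y`. -/
lemma bernoulli_bounds {y : ℝ} (h0 : 0 < y) (h1 : y ≤ 26 / 25) :
    1 - y / 2 + y ^ 2 / 12 - y ^ 4 / 720 ≤ y / (Real.exp y - 1) ∧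
    y / (Real.exp y - 1) ≤ 1 - y / 2 + y ^ 2 / 12 - y ^ 4 / 720 + y ^ 6 / 30240 := by
  have hpos : 0 < Real.exp y - 1 := by linarith [Real.add_one_lt_exp h0.ne']
  have hp : ∀ n : ℕ, y ^ (n + 7) ≤ y ^ 7 * (26 / 25) ^ n := fun n => by
    rw [pow_add, mul_comm]
    gcongr
  have h7 : 0 < y ^ 7 := by positivity
  constructor
  · rw [le_div_iff₀ hpos]
    have hA : 0 ≤ 1 - y / 2 + y ^ 2 / 12 - y ^ 4 / 720 := by
      have : y ^ 4 ≤ y ^ 2 * (26 / 25) ^ 2 := by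
        rw [show y ^ 4 = y ^ 2 * y ^ 2 by ring]
        gcongr
      nlinarith [sq_nonneg y]
    refine (mul_le_mul_of_nonneg_left
      (sub_le_sub_right (exp_le_taylor_seven h0.le h1) 1) hA).trans ?_
    rw [← sub_nonneg]
    have e8 := hp 1
    have e9 := hp 2
    have e10 := hp 3
    have e11 := hp 4
    have e12 := hp 5
    norm_num at e8 e9 e10 e11 e12
    have f8 : 0 ≤ y ^ 8 := by positivity
    have f9 : 0 ≤ y ^ 9 := by positivity
    have f10 : 0 ≤ y ^ 10 := by positivity
    have f11 : 0 ≤ y ^ 11 := by positivity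
    have f12 : 0 ≤ y ^ 12 := by positivity
    ring_nf
    linarith
  · rw [div_le_iff₀ hpos]
    have hA : 0 ≤ 1 - y / 2 + y ^ 2 / 12 - y ^ 4 / 720 + y ^ 6 / 30240 := by
      have : y ^ 4 ≤ y ^ 2 * (26 / 25) ^ 2 := by
        rw [show y ^ 4 = y ^ 2 * y ^ 2 by ring]
        gcongr
      have : 0 ≤ y ^ 6 := by positivity
      nlinarith [sq_nonneg y]
    have hexp := Real.sum_le_exp_of_nonneg h0.le 11
    norm_num [Finset.sum_range_succ, Nat.factorial] at hexp
    refine le_trans ?_ (mul_le_mul_of_nonneg_left (sub_le_sub_right hexp 1) hA)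
    rw [← sub_nonneg]
    have hq : ∀ n : ℕ, y ^ (n + 9) ≤ y ^ 9 * (26 / 25) ^ n := fun n => by
      rw [pow_add, mul_comm]
      gcongr
    have e10 := hq 1
    have e11 := hq 2
    have e12 := hq 3
    have e13 := hq 4
    have e14 := hq 5
    have e15 := hq 6
    have e16 := hq 7
    norm_num at e10 e11 e12 e13 e14 e15 e16
    have f9 : 0 ≤ y ^ 9 := by positivity
    have f10 : 0 ≤ y ^ 10 := by positivity
    have f11 : 0 ≤ y ^ 11 := by positivity
    have f12 : 0 ≤ y ^ 12 := by positivity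
    have f13 : 0 ≤ y ^ 13 := by positivity
    have f14 : 0 ≤ y ^ 14 := by positivity
    have f15 : 0 ≤ y ^ 15 := by positivity
    have f16 : 0 ≤ y ^ 16 := by positivity
    ring_nf
    linarith

/-- The upper approximation of `φ_q(x)`, where `q = exp (-t)` and `1 - q = t - t² σ`. -/
noncomputable def phiUpper (t σ x : ℝ) : ℝ :=
  1 / 2 - t * x / 6 + t ^ 3 * x ^ 3 / 180 - σ * (x⁻¹ - t ^ 2 * x / 12 + t ^ 4 * x ^ 3 / 240)

lemma phi_bounds {t σ x : ℝ} (ht : 0 < t) (hx : 0 < x) (hy : t * x ≤ 26 / 25)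
    (hσ0 : 0 ≤ σ) (hσ1 : t * σ ≤ 1) (hσ : 1 - Real.exp (-t) = t - t ^ 2 * σ) :
    phiUpper t σ x - t ^ 5 * x ^ 5 / 3780 ≤ phi (Real.exp (-t)) x ∧
      phi (Real.exp (-t)) x ≤ phiUpper t σ x := by
  have hy0 : 0 < t * x := by positivity
  obtain ⟨hl, hu⟩ := bernoulli_bounds hy0 hy
  have hpos : 0 < Real.exp (t * x) - 1 := by linarith [Real.add_one_lt_exp hy0.ne']
  have hphi : phi (Real.exp (-t)) x = (-(t * x / (Real.exp (t * x) - 1)) + (1 - t * σ) *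
      ((t * x / (Real.exp (t * x) - 1) + t * x / 2) ^ 2 - (t * x) ^ 2 / 4)) / (t * x) := by
    have hq : Real.exp (-t) = 1 - t + t ^ 2 * σ := by linarith
    have hr : Real.exp (-t) ^ x = (Real.exp (t * x))⁻¹ := by
      rw [← Real.exp_mul, ← Real.exp_neg]
      ring_nf
    have he := Real.exp_pos (t * x)
    unfold phi
    rw [hr, hq]
    generalize Real.exp (t * x) = E at *
    have h1 : 1 - E⁻¹ ≠ 0 := by
      have : 1 - E⁻¹ = (E - 1) / E := by field_simp
      rw [this]
      positivity
    have h2 := hpos.ne'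
    have h3 : (1 - E⁻¹) = (E - 1) / E := by field_simp
    rw [h3]
    field_simp
    ring
  have hU : phiUpper t σ x = ((-(1 - t * x / 2 + (t * x) ^ 2 / 12 - (t * x) ^ 4 / 720)) +
      (1 - t * σ) * (1 - (t * x) ^ 2 / 12 + (t * x) ^ 4 / 240)) / (t * x) := by
    unfold phiUpper
    field_simp
    ring
  have hL : phiUpper t σ x - t ^ 5 * x ^ 5 / 3780 =
      ((-(1 - t * x / 2 + (t * x) ^ 2 / 12 - (t * x) ^ 4 / 720)) +
      (1 - t * σ) * (1 - (t * x) ^ 2 / 12 + (t * x) ^ 4 / 240) - (t * x) ^ 6 / 3780) / (t * x) := by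
    rw [hU]
    field_simp
  rw [hL, hU, hphi]
  generalize t * x / (Real.exp (t * x) - 1) = a at *
  generalize t * x = y at *
  have hs0 : 0 ≤ t * σ := by positivity
  have hsq : y ^ 2 ≤ (26 / 25) ^ 2 := by gcongr
  have hw : 0 < y ^ 2 := by positivity
  have h6 : 0 < y ^ 6 := by positivity
  have h8 : y ^ 8 ≤ y ^ 6 * (26 / 25) ^ 2 := by
    rw [show y ^ 8 = y ^ 6 * y ^ 2 by ring]; gcongr
  have h12 : y ^ 12 ≤ y ^ 6 * (26 / 25) ^ 6 := by
    rw [show y ^ 12 = y ^ 6 * y ^ 6 by ring]; gcongr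
  have h80 : 0 ≤ y ^ 8 := by positivity
  have h10 : 0 ≤ y ^ 10 := by positivity
  have hbase : 0 ≤ 1 + y ^ 2 / 12 - y ^ 4 / 720 := by nlinarith
  have hBu : (a + y / 2) ^ 2 - y ^ 2 / 4 ≤ 1 - y ^ 2 / 12 + y ^ 4 / 240 := by
    have : (a + y / 2) ^ 2 ≤ (1 + y ^ 2 / 12 - y ^ 4 / 720 + y ^ 6 / 30240) ^ 2 :=
      pow_le_pow_left₀ (by linarith) (by linarith) 2
    nlinarith
  have hBl : 1 - y ^ 2 / 12 + y ^ 4 / 240 - y ^ 6 / 4320 ≤ (a + y / 2) ^ 2 - y ^ 2 / 4 := by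
    have : (1 + y ^ 2 / 12 - y ^ 4 / 720) ^ 2 ≤ (a + y / 2) ^ 2 :=
      pow_le_pow_left₀ hbase (by linarith) 2
    nlinarith
  have hs : 0 ≤ 1 - t * σ := by linarith
  have m1 := mul_le_mul_of_nonneg_left hBu hs
  have m2 := mul_le_mul_of_nonneg_left hBl hs
  have m3 : 0 ≤ t * σ * y ^ 6 := by positivity
  constructor
  · apply div_le_div_of_nonneg_right _ hy0.le
    linarith
  · apply div_le_div_of_nonneg_right _ hy0.le
    linarith

lemma log_eleven_lt : Real.log 11 < 2.398 := by
  have h : Real.log ((11 : ℝ) ^ 37) < Real.log ((2 : ℝ) ^ 128) :=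
    Real.log_lt_log (by norm_num) (by norm_num)
  rw [Real.log_pow, Real.log_pow] at h
  push_cast at h
  linarith [Real.log_two_lt_d9]

lemma integral_phiUpper_sub (t σ : ℝ) :
    ∫ x in (1 : ℝ)..11, (phiUpper t σ x - t ^ 5 * x ^ 5 / 3780) =
      5 - 10 * t + t ^ 3 * 61 / 3 - σ * (Real.log 11 - 5 * t ^ 2 + t ^ 4 * 61 / 4)
        - t ^ 5 * 1771560 / 22680 := by
  have hderiv : ∀ x ∈ Set.uIcc (1 : ℝ) 11, HasDerivAt
      (fun x : ℝ => x / 2 - t * x ^ 2 / 12 + t ^ 3 * x ^ 4 / 720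
        - σ * (Real.log x - t ^ 2 * x ^ 2 / 24 + t ^ 4 * x ^ 4 / 960) - t ^ 5 * x ^ 6 / 22680)
      (phiUpper t σ x - t ^ 5 * x ^ 5 / 3780) x := by
    intro x hx
    rw [Set.uIcc_of_le (by norm_num)] at hx
    have hx0 : x ≠ 0 := by linarith [hx.1]
    have h := (((((hasDerivAt_id x).div_const 2).sub
      (((hasDerivAt_pow 2 x).const_mul t).div_const 12)).add
      (((hasDerivAt_pow 4 x).const_mul (t ^ 3)).div_const 720)).sub
      ((((Real.hasDerivAt_log hx0).sub
        (((hasDerivAt_pow 2 x).const_mul (t ^ 2)).div_const 24)).add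
        (((hasDerivAt_pow 4 x).const_mul (t ^ 4)).div_const 960)).const_mul σ)).sub
      (((hasDerivAt_pow 6 x).const_mul (t ^ 5)).div_const 22680)
    refine h.congr_deriv ?_
    unfold phiUpper
    push_cast
    ring
  rw [intervalIntegral.integral_eq_sub_of_hasDerivAt hderiv]
  · rw [Real.log_one]
    ring
  · apply ContinuousOn.intervalIntegrable
    rw [Set.uIcc_of_le (by norm_num)]
    unfold phiUpper
    have : ∀ x ∈ Set.Icc (1 : ℝ) 11, x ≠ 0 := fun x hx => by linarith [hx.1]
    fun_prop (disch := assumption)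

lemma intervalIntegrable_phi_s19 {q : ℝ} (h0 : 0 < q) (h1 : q < 1) :
    IntervalIntegrable (phi q) MeasureTheory.volume 1 11 := by
  apply ContinuousOn.intervalIntegrable
  rw [Set.uIcc_of_le (by norm_num)]
  have hc : Continuous fun x : ℝ => q ^ x := Real.continuous_const_rpow h0.ne'
  unfold phi
  refine ContinuousOn.div (by fun_prop) (by fun_prop) fun x hx => ?_
  have := Real.rpow_lt_one h0.le h1 (by linarith [hx.1] : 0 < x)
  exact pow_ne_zero 2 (by linarith)

/-- For `q ∈ [0.91, 1)`,
`D_q(10) = ∫_1^{11} φ_q(x) dx - (∑_{k=1}^{10} φ_q(k) + φ_q(11)/2) > 0.036`. -/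
theorem DQ_ten_gt (q : ℝ) (hq : q ∈ Set.Ico (0.91 : ℝ) 1) :
    0.036 < (∫ x in (1 : ℝ)..11, phi q x) -
      ((∑ k ∈ Finset.Icc (1 : ℕ) 10, phi q (k : ℝ)) + phi q 11 / 2) := by
  obtain ⟨hq0, hq1⟩ := hq
  have hqpos : 0 < q := by linarith
  obtain ⟨t, rfl⟩ : ∃ t, q = Real.exp (-t) := ⟨-Real.log q, by rw [neg_neg, Real.exp_log hqpos]⟩
  have ht0 : 0 < t := by
    rw [Real.exp_lt_one_iff] at hq1
    linarith
  have ht1 : t ≤ 0.0944 := by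
    by_contra! h
    have h1 := Real.sum_le_exp_of_nonneg (show (0 : ℝ) ≤ 0.0944 by norm_num) 4
    norm_num [Finset.sum_range_succ, Nat.factorial] at h1
    have h3 : Real.exp (-t) * Real.exp t = 1 := by rw [← Real.exp_add]; simp
    have h4 : (804928627 / 732421875 : ℝ) ≤ Real.exp t := by
      exact h1.trans (Real.exp_le_exp.2 (by norm_num at h; linarith))
    norm_num at hq0
    nlinarith [Real.exp_pos t]
  obtain ⟨σ, hσ⟩ : ∃ σ, 1 - Real.exp (-t) = t - t ^ 2 * σ :=
    ⟨(t - (1 - Real.exp (-t))) / t ^ 2, by field_simp; ring⟩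
  have ht2 : 0 < t ^ 2 := by positivity
  have hσ1 : t * σ ≤ 1 := by
    by_contra! h
    nlinarith
  have hσ0 : 1 / 2 - t / 6 ≤ σ := by
    have hb := Real.exp_bound (x := -t) (by rw [abs_neg, abs_of_pos ht0]; linarith)
      (n := 5) (by norm_num)
    rw [abs_neg, abs_of_pos ht0] at hb
    have hb' := (abs_le.1 hb).1
    norm_num [Finset.sum_range_succ, Nat.factorial] at hb'
    have h5 : t ^ 5 ≤ t ^ 4 * 0.0944 := by
      rw [pow_succ]
      gcongr
    have h4 : 0 ≤ t ^ 4 := by positivity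
    have : t ^ 2 * (1 / 2 - t / 6) ≤ t ^ 2 * σ := by
      nlinarith
    exact le_of_mul_le_mul_left this ht2
  have hσn : 0 ≤ σ := by linarith
  have hint : (∫ x in (1 : ℝ)..11, (phiUpper t σ x - t ^ 5 * x ^ 5 / 3780)) ≤
      ∫ x in (1 : ℝ)..11, phi (Real.exp (-t)) x := by
    apply intervalIntegral.integral_mono_on (by norm_num) _ (intervalIntegrable_phi_s19 hqpos hq1)
    · intro x hx
      exact (phi_bounds ht0 (by linarith [hx.1]) (by nlinarith [hx.1, hx.2]) hσn hσ1 hσ).1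
    · apply ContinuousOn.intervalIntegrable
      rw [Set.uIcc_of_le (by norm_num)]
      unfold phiUpper
      have : ∀ x ∈ Set.Icc (1 : ℝ) 11, x ≠ 0 := fun x hx => by linarith [hx.1]
      fun_prop (disch := assumption)
  rw [integral_phiUpper_sub] at hint
  have hphi1 : phi (Real.exp (-t)) 1 = 0 := by simp [phi]
  have hphi : ∀ k : ℕ, 0 < k → k ≤ 11 → phi (Real.exp (-t)) k ≤ phiUpper t σ k := by
    intro k hk hk'
    have h1 : (0 : ℝ) < k := by exact_mod_cast hk
    have h2 : (k : ℝ) ≤ 11 := by exact_mod_cast hk'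
    exact (phi_bounds ht0 h1 (by nlinarith) hσn hσ1 hσ).2
  have u1 := hphi 1 (by norm_num) (by norm_num)
  have u2 := hphi 2 (by norm_num) (by norm_num)
  have u3 := hphi 3 (by norm_num) (by norm_num)
  have u4 := hphi 4 (by norm_num) (by norm_num)
  have u5 := hphi 5 (by norm_num) (by norm_num)
  have u6 := hphi 6 (by norm_num) (by norm_num)
  have u7 := hphi 7 (by norm_num) (by norm_num)
  have u8 := hphi 8 (by norm_num) (by norm_num)
  have u9 := hphi 9 (by norm_num) (by norm_num)
  have u10 := hphi 10 (by norm_num) (by norm_num)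
  have u11 := hphi 11 (by norm_num) (by norm_num)
  rw [Nat.cast_one] at u1
  norm_num [Finset.sum_Icc_succ_top]
  rw [hphi1] at u1 ⊢
  simp only [phiUpper, Nat.cast_ofNat] at u1 u2 u3 u4 u5 u6 u7 u8 u9 u10 u11
  have hlog : (0.0764 : ℝ) * (1 / 2 - t / 6) ≤ (2.4744 - Real.log 11) * σ :=
    mul_le_mul (by linarith [log_eleven_lt]) hσ0 (by linarith) (by linarith [log_eleven_lt])
  have hσt : 0 ≤ σ * t ^ 4 := by positivity
  have h3 : t ^ 3 ≤ 0.0944 ^ 3 := by gcongr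
  have h5 : t ^ 5 ≤ 0.0944 ^ 5 := by gcongr
  norm_num at u1 h3 h5 hlog ht1
  linarith
end
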